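/- Fix μ ∈ ℝ and σ > 0. Let γ₁ be the standard Gaussian measure on ℝ and let γ₃ be the standard Gaussian measure on ℝ³. Then the pushforward of the product measure γ₁ ⊗ γ₃ under the map (r, x) ↦ exp(μ + σ·r) · x/‖x‖ (defined for x ≠ 0, which holds γ₃-almost everywhere) is the measure on ℝ³ that has density f₃ with respect to Lebesgue measure. In other words, the paper's sampling procedure produces exactly the Spherical Log-Normal distribution. -/

import Mathlib

open Real MeasureTheory Classical

/-- The Spherical Log-Normal density on ℝ³ with parameters `μ` and `σ`. -/
noncomputable def sphericalLogNormalDensity (μ σ : ℝ) (x : EuclideanSpace ℝ (Fin 3)) : ℝ :=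
  if x = 0 then 0
  else (1 / (2 * (2 * π) ^ ((3 : ℝ) / 2) * σ * ‖x‖ ^ 3)) *
    Real.exp (-(Real.log ‖x‖ - μ) ^ 2 / (2 * σ ^ 2))

/-- The standard Gaussian measure on ℝ, with density `(2π)^{-1/2}·exp(-t²/2)`
with respect to Lebesgue measure. -/
noncomputable def stdGaussian1 : Measure ℝ :=
  volume.withDensity fun t =>
    ENNReal.ofReal ((2 * π) ^ (-(1 : ℝ) / 2) * Real.exp (-t ^ 2 / 2))

/-- The standard Gaussian measure on ℝ³, with density `(2π)^{-3/2}·exp(-‖x‖²/2)`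
with respect to Lebesgue measure. -/
noncomputable def stdGaussian3 : Measure (EuclideanSpace ℝ (Fin 3)) :=
  volume.withDensity fun x =>
    ENNReal.ofReal ((2 * π) ^ (-(3 : ℝ) / 2) * Real.exp (-‖x‖ ^ 2 / 2))

/-- Polar coordinates for the Lebesgue integral with respect to an additive Haar measure. -/
theorem lintegral_eq_lintegral_toSphere_Ioi {E : Type*} [NormedAddCommGroup E] [NormedSpace ℝ E]
    [Nontrivial E] [FiniteDimensional ℝ E] [MeasurableSpace E] [BorelSpace E]
    (ν : Measure E) [ν.IsAddHaarMeasure] {F : E → ENNReal} (hF : Measurable F) :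
    ∫⁻ x, F x ∂ν = ∫⁻ s, (∫⁻ r in Set.Ioi (0 : ℝ),
      ENNReal.ofReal (r ^ (Module.finrank ℝ E - 1)) * F (r • (s : E))) ∂ν.toSphere := by
  have hmeas : Measurable fun p : Metric.sphere (0 : E) 1 × Set.Ioi (0 : ℝ) =>
      F ((p.2 : ℝ) • (p.1 : E)) := by fun_prop
  calc
    ∫⁻ x, F x ∂ν = ∫⁻ x : ({(0)}ᶜ : Set E), F x ∂(ν.comap (↑)) := by
      rw [lintegral_subtype_comap (measurableSet_singleton _).compl,
        restrict_compl_singleton]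
    _ = ∫⁻ p, F ((p.2 : ℝ) • (p.1 : E))
          ∂ν.toSphere.prod (.volumeIoiPow (Module.finrank ℝ E - 1)) := by
      rw [← ν.measurePreserving_homeomorphUnitSphereProd.lintegral_comp hmeas]
      refine lintegral_congr fun x => ?_
      have hx : ‖(x : E)‖ ≠ 0 := norm_ne_zero_iff.2 x.2
      simp [smul_smul, hx]
    _ = _ := by
      rw [lintegral_prod _ hmeas.aemeasurable]
      refine lintegral_congr fun s => ?_
      rw [Measure.volumeIoiPow, lintegral_withDensity_eq_lintegral_mul _ (by fun_prop)
        (by fun_prop), ← lintegral_subtype_comap measurableSet_Ioi]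
      rfl

theorem lintegral_Ioi_eq_lintegral_exp_affine (μ σ : ℝ) (hσ : 0 < σ) (h : ℝ → ENNReal) :
    ∫⁻ r in Set.Ioi (0 : ℝ), h r =
      ∫⁻ t, ENNReal.ofReal (σ * Real.exp (μ + σ * t)) * h (Real.exp (μ + σ * t)) := by
  have himage : (fun t : ℝ => Real.exp (μ + σ * t)) '' Set.univ = Set.Ioi 0 := by
    ext r
    simp only [Set.image_univ, Set.mem_range, Set.mem_Ioi]
    refine ⟨fun ⟨t, ht⟩ => ht ▸ Real.exp_pos _, fun hr => ⟨(Real.log r - μ) / σ, ?_⟩⟩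
    rw [mul_div_cancel₀ _ hσ.ne', add_sub_cancel, Real.exp_log hr]
  rw [← himage, lintegral_image_eq_lintegral_abs_deriv_mul
    (f' := fun t => σ * Real.exp (μ + σ * t)) MeasurableSet.univ, Measure.restrict_univ]
  · refine lintegral_congr fun t => ?_
    rw [abs_of_pos (by positivity)]
  · intro t _
    have := (((hasDerivAt_id t).const_mul σ).const_add μ).exp
    simpa [mul_comm] using this
  · intro a _ b _ hab
    have := Real.exp_injective hab
    simpa [hσ.ne'] using this

theorem lintegral_Ioi_sq_mul_gaussian :
    ∫⁻ r in Set.Ioi (0 : ℝ), ENNReal.ofReal (r ^ 2) *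
      ENNReal.ofReal ((2 * π) ^ (-(3 : ℝ) / 2) * Real.exp (-r ^ 2 / 2)) =
      ENNReal.ofReal (1 / (4 * π)) := by
  have hint : IntegrableOn (fun r : ℝ => r ^ (2 : ℝ) * Real.exp (-(1 / 2) * r ^ (2 : ℝ)))
      (Set.Ioi 0) :=
    integrableOn_rpow_mul_exp_neg_mul_rpow (by norm_num) (by norm_num) (by norm_num)
  have hval := integral_rpow_mul_exp_neg_mul_rpow (p := 2) (q := 2) (b := 1 / 2)
    (by norm_num) (by norm_num) (by norm_num)
  have hΓ : Real.Gamma ((2 + 1) / 2) = 1 / 2 * π ^ ((1 : ℝ) / 2) := by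
    rw [show ((2 : ℝ) + 1) / 2 = 1 / 2 + 1 by norm_num, Real.Gamma_add_one (by norm_num),
      Real.Gamma_one_half_eq, Real.sqrt_eq_rpow]
  have hconst : (2 * π) ^ (-(3 : ℝ) / 2) *
      ((1 / 2 : ℝ) ^ (-(2 + 1 : ℝ) / 2) * (1 / 2) * (1 / 2 * π ^ ((1 : ℝ) / 2))) =
      1 / (4 * π) := by
    have htwo : (2 * π) ^ (-(3 : ℝ) / 2) * (1 / 2 : ℝ) ^ (-(2 + 1 : ℝ) / 2) =
        π ^ (-(3 : ℝ) / 2) := by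
      rw [show (-(2 + 1 : ℝ) / 2) = -3 / 2 by norm_num,
        ← Real.mul_rpow (by positivity) (by positivity)]
      congr 1
      ring
    have hpi : π ^ (-(3 : ℝ) / 2) * π ^ ((1 : ℝ) / 2) = π⁻¹ := by
      rw [← Real.rpow_add Real.pi_pos, ← Real.rpow_neg_one]
      norm_num
    calc
      _ = ((2 * π) ^ (-(3 : ℝ) / 2) * (1 / 2 : ℝ) ^ (-(2 + 1 : ℝ) / 2)) *
          π ^ ((1 : ℝ) / 2) / 4 := by ring
      _ = 1 / (4 * π) := by
        rw [htwo, hpi]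
        field_simp
  rw [← hconst, ← hΓ, ← hval, ← integral_const_mul,
    ofReal_integral_eq_lintegral_ofReal (hint.const_mul _)
      ((ae_restrict_mem measurableSet_Ioi).mono fun r (hr : 0 < r) => by positivity)]
  refine lintegral_congr fun r => ?_
  rw [← ENNReal.ofReal_mul (by positivity), Real.rpow_two,
    show -r ^ 2 / 2 = -(1 / 2) * r ^ 2 by ring]
  congr 1
  ring

theorem mul_cube_mul_sphericalLogNormalDensity (μ σ : ℝ) (hσ : 0 < σ) (t : ℝ)
    (s : Metric.sphere (0 : EuclideanSpace ℝ (Fin 3)) 1) :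
    σ * Real.exp (μ + σ * t) * (Real.exp (μ + σ * t) ^ 2 *
      sphericalLogNormalDensity μ σ (Real.exp (μ + σ * t) • (s : EuclideanSpace ℝ (Fin 3)))) =
      1 / (4 * π) * ((2 * π) ^ (-(1 : ℝ) / 2) * Real.exp (-t ^ 2 / 2)) := by
  have hs : ‖(s : EuclideanSpace ℝ (Fin 3))‖ = 1 := by simp
  have hne : Real.exp (μ + σ * t) • (s : EuclideanSpace ℝ (Fin 3)) ≠ 0 := by
    rw [← norm_ne_zero_iff, norm_smul, hs]
    simp
  have hpow : (2 * π) ^ (-(1 : ℝ) / 2) * (2 * π) ^ ((3 : ℝ) / 2) = 2 * π := by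
    rw [← Real.rpow_add (by positivity)]
    norm_num
  have hexp : -(σ * t) ^ 2 / (2 * σ ^ 2) = -t ^ 2 / 2 := by
    field_simp
  rw [sphericalLogNormalDensity, if_neg hne, norm_smul, hs, mul_one, Real.norm_eq_abs,
    abs_of_pos (Real.exp_pos _), Real.log_exp, add_sub_cancel_left, hexp]
  generalize Real.exp (-t ^ 2 / 2) = e
  have hE := Real.exp_pos (μ + σ * t)
  generalize Real.exp (μ + σ * t) = E at hE
  have hA : 0 < (2 * π) ^ ((3 : ℝ) / 2) := by positivity
  generalize (2 * π) ^ ((3 : ℝ) / 2) = A at *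
  generalize (2 * π) ^ (-(1 : ℝ) / 2) = B at *
  have hπ := Real.pi_pos
  field_simp
  linear_combination (-2 * e) * hpow

theorem measurable_sphericalLogNormalDensity (μ σ : ℝ) :
    Measurable (sphericalLogNormalDensity μ σ) := by
  unfold sphericalLogNormalDensity
  refine Measurable.ite (measurableSet_singleton 0) measurable_const ?_
  fun_prop

/-- Sampling `r` from a standard Gaussian on ℝ and `x` from a standard Gaussian on ℝ³
and forming `exp(μ + σ·r) · x/‖x‖` produces exactly the Spherical Log-Normal
distribution, i.e. the measure on ℝ³ with density `f₃` w.r.t. Lebesgue measure. -/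
theorem map_gaussian_prod_eq_sphericalLogNormal (μ σ : ℝ) (hσ : 0 < σ) :
    Measure.map (fun p : ℝ × EuclideanSpace ℝ (Fin 3) =>
        Real.exp (μ + σ * p.1) • (‖p.2‖⁻¹ • p.2)) (stdGaussian1.prod stdGaussian3) =
      volume.withDensity fun x => ENNReal.ofReal (sphericalLogNormalDensity μ σ x) := by
  have hT : Measurable fun p : ℝ × EuclideanSpace ℝ (Fin 3) =>
      Real.exp (μ + σ * p.1) • (‖p.2‖⁻¹ • p.2) := by fun_prop
  have : SFinite stdGaussian3 := by unfold stdGaussian3; infer_instance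
  have hf := measurable_sphericalLogNormalDensity μ σ
  have hdim : Module.finrank ℝ (EuclideanSpace ℝ (Fin 3)) - 1 = 2 := by simp
  refine Measure.ext_of_lintegral _ fun g hg => ?_
  have hinner (t : ℝ) : ∫⁻ x, g (Real.exp (μ + σ * t) • (‖x‖⁻¹ • x)) ∂stdGaussian3 =
      ENNReal.ofReal (1 / (4 * π)) * ∫⁻ s : Metric.sphere (0 : EuclideanSpace ℝ (Fin 3)) 1,
        g (Real.exp (μ + σ * t) • (s : EuclideanSpace ℝ (Fin 3)))
          ∂(volume : Measure (EuclideanSpace ℝ (Fin 3))).toSphere := by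
    rw [stdGaussian3, lintegral_withDensity_eq_lintegral_mul _ (by fun_prop) (by fun_prop),
      lintegral_eq_lintegral_toSphere_Ioi _ (by fun_prop), ← lintegral_const_mul _ (by fun_prop)]
    refine lintegral_congr fun s => ?_
    rw [← lintegral_Ioi_sq_mul_gaussian, ← lintegral_mul_const _ (by fun_prop)]
    refine setLIntegral_congr_fun measurableSet_Ioi fun r (hr : 0 < r) => ?_
    simp [norm_smul, abs_of_pos hr, smul_smul, hr.ne', mul_assoc]
  rw [lintegral_map hg hT, lintegral_prod _ (by fun_prop)]
  simp only [hinner]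
  rw [stdGaussian1, lintegral_withDensity_eq_lintegral_mul _ (by fun_prop) (by fun_prop),
    lintegral_withDensity_eq_lintegral_mul _ (by fun_prop) hg,
    lintegral_eq_lintegral_toSphere_Ioi (volume : Measure (EuclideanSpace ℝ (Fin 3)))
      (by fun_prop), hdim]
  simp only [lintegral_Ioi_eq_lintegral_exp_affine μ σ hσ, Pi.mul_apply]
  rw [lintegral_lintegral_swap (by fun_prop)]
  refine lintegral_congr fun t => ?_
  rw [← mul_assoc, ← lintegral_const_mul _ (by fun_prop)]
  refine lintegral_congr fun s => ?_
  simp only [← mul_assoc]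
  rw [← ENNReal.ofReal_mul (by positivity), ← ENNReal.ofReal_mul (by positivity),
    ← ENNReal.ofReal_mul (by positivity), mul_comm _ (1 / (4 * π)),
    ← mul_cube_mul_sphericalLogNormalDensity μ σ hσ t s, mul_assoc (σ * _)]
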